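/- arXiv:2307.08137 — 2 statements merged into one kernel-verified Lean document; each statement's English description precedes it below -/
import Mathlib

section
/- (Ehrhart's theorem) Let K be a convex polytope in ℝ^n with positive volume and all vertices in ℤ^n. Then there exists a polynomial p of degree n with rational coefficients and leading coefficient equal to Vol_n(K) such that for every positive integer r, the number of integer lattice points in the dilate rK equals p(r): |ℤ^n ∩ rK| = p(r). -/
open Pointwise MeasureTheory
noncomputable section

namespace Ehrhart

open Filter Topology

/-! ### Lexicographically maximal nonnegative representations -/

/-- A nonempty compact subset of `Fin k → ℝ` has a lexicographically largest element. -/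
theorem exists_forall_toLex_le {k : ℕ} {C : Set (Fin k → ℝ)} (hC : IsCompact C)
    (hne : C.Nonempty) : ∃ x ∈ C, ∀ y ∈ C, toLex y ≤ toLex x := by
  have key : ∀ m : ℕ, ∃ x ∈ C, ∀ y ∈ C, (∀ i : Fin k, i.1 < m → y i = x i) ∨
      toLex y < toLex x := by
    intro m
    induction m with
    | zero =>
      obtain ⟨x, hx⟩ := hne
      exact ⟨x, hx, fun y _ => Or.inl fun i hi => absurd hi (Nat.not_lt_zero _)⟩
    | succ m ih =>
      obtain ⟨x, hx, hmax⟩ := ih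
      rcases lt_or_ge m k with hm | hm
      · let D : Set (Fin k → ℝ) := C ∩ {y | ∀ i : Fin k, i.1 < m → y i = x i}
        have hclosed : IsClosed {y : Fin k → ℝ | ∀ i : Fin k, i.1 < m → y i = x i} := by
          simp only [Set.ofPred_forall]
          exact isClosed_iInter fun i => isClosed_iInter fun _ =>
            isClosed_eq (continuous_apply i) continuous_const
        obtain ⟨z, hz, hzmax⟩ := (hC.inter_right hclosed).exists_isMaxOn
          (⟨x, hx, fun _ _ => rfl⟩ : D.Nonempty)
          (continuous_apply (⟨m, hm⟩ : Fin k)).continuousOn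
        refine ⟨z, hz.1, fun y hy => ?_⟩
        by_cases h : ∀ i : Fin k, i.1 < m → y i = x i
        · have hle : y ⟨m, hm⟩ ≤ z ⟨m, hm⟩ := hzmax ⟨hy, h⟩
          rcases hle.eq_or_lt with heq | hlt
          · left
            intro i hi
            rcases Nat.lt_succ_iff_lt_or_eq.1 hi with hi | hi
            · rw [h i hi, hz.2 i hi]
            · obtain rfl : i = ⟨m, hm⟩ := Fin.ext hi
              exact heq
          · right
            refine ⟨⟨m, hm⟩, fun j hj => ?_, hlt⟩
            change y j = z j
            rw [h j hj, hz.2 j hj]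
        · right
          obtain ⟨i, hi, hlt⟩ := (hmax y hy).resolve_left h
          have him : i.1 < m := by
            by_contra! him
            exact h fun j hj => hi j (hj.trans_le him)
          refine ⟨i, fun j hj => ?_, ?_⟩
          · change y j = z j
            rw [hz.2 j (lt_trans hj him)]
            exact hi j hj
          · change y i < z i
            rw [hz.2 i him]
            exact hlt
      · exact ⟨x, hx, fun y hy => (hmax y hy).imp_left fun h i _ => h i (i.2.trans_le hm)⟩
  obtain ⟨x, hx, hmax⟩ := key k
  refine ⟨x, hx, fun y hy => (hmax y hy).elim (fun h => ?_) le_of_lt⟩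
  exact le_of_eq (congrArg toLex (funext fun i => h i i.2))

/-- A nonnegative vector is lexicographically maximal for the linear map `T` if no
lexicographically positive element of the kernel of `T` is nonnegative where the vector
vanishes. -/
def IsLexMax {k : ℕ} {E : Type*} [AddCommGroup E] [Module ℝ E] (T : (Fin k → ℝ) →ₗ[ℝ] E)
    (a : Fin k → ℝ) : Prop :=
  ∀ c, T c = 0 → (∀ i, a i = 0 → 0 ≤ c i) → toLex c ≤ 0

section LexMax

variable {k : ℕ} {E : Type*} [AddCommGroup E] [Module ℝ E] {T : (Fin k → ℝ) →ₗ[ℝ] E}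

theorem IsLexMax.congr {a b : Fin k → ℝ} (ha : IsLexMax T a) (h : ∀ i, a i = 0 → b i = 0) :
    IsLexMax T b :=
  fun c hc hb => ha c hc fun i hi => hb i (h i hi)

theorem IsLexMax.eq {a b : Fin k → ℝ} (ha : IsLexMax T a) (hb : IsLexMax T b) (ha0 : 0 ≤ a)
    (hb0 : 0 ≤ b) (h : T a = T b) : a = b := by
  have h1 : toLex (b - a) ≤ 0 := ha _ (by simp [h]) fun i hi => by simpa [hi] using hb0 i
  have h2 : toLex (a - b) ≤ 0 := hb _ (by simp [h]) fun i hi => by simpa [hi] using ha0 i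
  exact toLex.injective (le_antisymm (sub_nonpos.1 h2) (sub_nonpos.1 h1))

theorem exists_isLexMax [TopologicalSpace E] [IsTopologicalAddGroup E] [ContinuousSMul ℝ E]
    [T2Space E] (hT : ∀ c, T c = 0 → ∑ i, c i = 0) {a : Fin k → ℝ} (ha : 0 ≤ a) :
    ∃ b, 0 ≤ b ∧ T b = T a ∧ IsLexMax T b := by
  have hTc : Continuous T := T.continuous_on_pi
  have hsum : ∀ b, T b = T a → ∑ i, b i = ∑ i, a i := fun b hb => by
    have := hT (b - a) (by simp [hb])
    simpa [sub_eq_zero] using this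
  have hC : IsCompact {b : Fin k → ℝ | 0 ≤ b ∧ T b = T a} := by
    refine (isCompact_Icc (a := (0 : Fin k → ℝ)) (b := fun _ => ∑ i, a i)).of_isClosed_subset
      ((isClosed_le continuous_const continuous_id).inter
        (isClosed_eq hTc continuous_const)) fun b hb => ⟨hb.1, fun i => ?_⟩
    rw [← hsum b hb.2]
    exact Finset.single_le_sum (fun j _ => hb.1 j) (Finset.mem_univ i)
  obtain ⟨b, ⟨hb0, hbT⟩, hmax⟩ := exists_forall_toLex_le hC ⟨a, ha, rfl⟩
  refine ⟨b, hb0, hbT, fun c hc hcb => ?_⟩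
  have hev : ∀ᶠ ε : ℝ in 𝓝[>] 0, ∀ i, 0 ≤ b i + ε * c i := by
    refine eventually_all.2 fun i => ?_
    rcases (hb0 i).eq_or_lt with h | h
    · filter_upwards [self_mem_nhdsWithin] with ε hε
      rw [← h]
      have := mul_nonneg (le_of_lt (Set.mem_Ioi.1 hε)) (hcb i h.symm)
      simpa using this
    · have : Tendsto (fun ε : ℝ => b i + ε * c i) (𝓝[>] 0) (𝓝 (b i + 0 * c i)) :=
        ((continuous_const.add (continuous_id.mul continuous_const)).tendsto 0).mono_left
          nhdsWithin_le_nhds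
      rw [zero_mul, add_zero] at this
      exact (this.eventually (lt_mem_nhds h)).mono fun _ => le_of_lt
  obtain ⟨ε, hε, hε0⟩ := (hev.and self_mem_nhdsWithin).exists
  have hε0 : 0 < ε := hε0
  have hle := hmax (b + ε • c) ⟨hε, by simp [hbT, hc]⟩
  by_contra! hcpos
  obtain ⟨i, hi, hlt⟩ := hcpos
  refine absurd hle (not_le.2 ⟨i, fun j hj => ?_, ?_⟩)
  · have : 0 = c j := hi j hj
    change b j = b j + ε * c j
    simp [← this]
  · have : 0 < c i := hlt
    change b i < b i + ε * c i
    have := mul_pos hε0 this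
    linarith

end LexMax

/-! ### Counting lattice points -/

/-- The number of ways to distribute `r - h` units into `s` boxes is polynomial in `r`. -/
theorem exists_polynomial_eval_choose {s h : ℕ} (hs : 0 < s) (hh : h ≤ s) :
    ∃ p : Polynomial ℚ, ∀ r : ℕ, 0 < r →
      p.eval (r : ℚ) = if h ≤ r then ((s + (r - h) - 1).choose (r - h) : ℚ) else 0 := by
  refine ⟨Polynomial.C ((s - 1).factorial : ℚ)⁻¹ *
    (descPochhammer ℚ (s - 1)).comp (Polynomial.X + Polynomial.C ((s : ℚ) - 1 - h)),
    fun r hr => ?_⟩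
  have hcast : (r : ℚ) + ((s : ℚ) - 1 - h) = ((r + s - 1 - h : ℕ) : ℚ) := by
    rw [Nat.cast_sub (by omega), Nat.cast_sub (by omega)]
    push_cast
    ring
  rw [Polynomial.eval_mul, Polynomial.eval_C, Polynomial.eval_comp, Polynomial.eval_add,
    Polynomial.eval_X, Polynomial.eval_C, hcast, descPochhammer_eval_eq_descFactorial,
    Nat.descFactorial_eq_factorial_mul_choose, Nat.cast_mul, inv_mul_cancel_left₀
      (by exact_mod_cast Nat.factorial_ne_zero _)]
  split_ifs with h1
  · rw [show s + (r - h) - 1 = (s - 1) + (r - h) by omega,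
      show r + s - 1 - h = (s - 1) + (r - h) by omega, Nat.choose_symm_add]
  · rw [Nat.choose_eq_zero_of_lt (by omega), Nat.cast_zero]

variable {k n : ℕ}

/-- The linear map taking coefficients to the corresponding combination of the vectors `v i`,
together with the sum of the coefficients. -/
def homogenization (v : Fin k → Fin n → ℤ) : (Fin k → ℝ) →ₗ[ℝ] (Fin n → ℝ) × ℝ :=
  (Fintype.linearCombination ℝ fun i j => (v i j : ℝ)).prod
    (Fintype.linearCombination ℝ fun _ => (1 : ℝ))

theorem homogenization_apply (v : Fin k → Fin n → ℤ) (a : Fin k → ℝ) :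
    homogenization v a = (fun j => ∑ i, a i * v i j, ∑ i, a i) := by
  ext <;> simp [homogenization, Fintype.linearCombination_apply]

/-- The lattice points of the `r`-fold dilate of the convex hull of the `v i`. -/
def dilateLatticePoints (v : Fin k → Fin n → ℤ) (r : ℕ) : Set (Fin n → ℤ) :=
  {x | ∃ a, 0 ≤ a ∧ homogenization v a = (fun j => (x j : ℝ), (r : ℝ))}

/-- The canonical coefficient vectors in the unit cube that represent lattice points. -/
def fundamentalSet (v : Fin k → Fin n → ℤ) : Set (Fin k → ℝ) :=
  {a | 0 ≤ a ∧ a ≤ 1 ∧ IsLexMax (homogenization v) a ∧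
    ∃ (x : Fin n → ℤ) (h : ℕ), homogenization v a = (fun j => (x j : ℝ), (h : ℝ))}

theorem finite_fundamentalSet (v : Fin k → Fin n → ℤ) : (fundamentalSet v).Finite := by
  have hinj : Set.InjOn (homogenization v) (fundamentalSet v) :=
    fun a ha b hb h => ha.2.2.1.eq hb.2.2.1 ha.1 hb.1 h
  refine Set.Finite.of_finite_image ?_ hinj
  let B : Fin n → ℤ := fun j => ∑ i, |v i j|
  refine ((Set.toFinite (Set.Icc (-B) B ×ˢ Set.Iic k)).image
    fun p : (Fin n → ℤ) × ℕ => ((fun j => (p.1 j : ℝ), (p.2 : ℝ)) : (Fin n → ℝ) × ℝ)).subset ?_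
  rintro _ ⟨a, ⟨ha0, ha1, -, x, h, hx⟩, rfl⟩
  refine ⟨(x, h), ?_, hx.symm⟩
  rw [homogenization_apply, Prod.mk.injEq] at hx
  have hxB : ∀ j, |x j| ≤ B j := fun j => by
    have hxj := congrFun hx.1 j
    have : |(x j : ℝ)| ≤ ∑ i, |(v i j : ℝ)| := by
      rw [← hxj]
      refine (Finset.abs_sum_le_sum_abs _ _).trans (Finset.sum_le_sum fun i _ => ?_)
      rw [abs_mul, abs_of_nonneg (ha0 i)]
      exact mul_le_of_le_one_left (abs_nonneg _) (ha1 i)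
    exact_mod_cast this
  refine ⟨⟨fun j => (abs_le.1 (hxB j)).1, fun j => (abs_le.1 (hxB j)).2⟩, ?_⟩
  have : (h : ℝ) ≤ k := by
    rw [← hx.2]
    exact (Finset.sum_le_sum fun i _ => ha1 i).trans (by simp)
  exact_mod_cast this

/-- The integral vectors supported where `a` is whose sum with `a` has coefficient sum `r`. -/
def integralTranslations (a : Fin k → ℝ) (r : ℕ) : Set (Fin k →₀ ℕ) :=
  {m | (∀ i, a i = 0 → m i = 0) ∧ ∑ i, (a i + m i) = r}

theorem integralTranslations_eq {a : Fin k → ℝ} {h : ℕ} (ha : ∑ i, a i = h) (r : ℕ) :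
    integralTranslations a r = if h ≤ r then
      ↑((Finset.univ.filter fun i => a i ≠ 0).finsuppAntidiag (r - h)) else ∅ := by
  ext m
  have hsum : (∀ i, a i = 0 → m i = 0) →
      ∑ i ∈ Finset.univ.filter (fun i => a i ≠ 0), m i = ∑ i, m i := fun hm =>
    Finset.sum_subset (Finset.filter_subset _ _) fun i _ hi => hm i (by simpa using hi)
  have hiff : m ∈ integralTranslations a r ↔
      (∀ i, a i = 0 → m i = 0) ∧ h + ∑ i, m i = r := by
    rw [integralTranslations, Set.mem_ofPred, Finset.sum_add_distrib, ha]
    exact and_congr_right fun _ => by exact_mod_cast Iff.rfl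
  have hsupp : m.support ⊆ Finset.univ.filter (fun i => a i ≠ 0) ↔
      ∀ i, a i = 0 → m i = 0 := by
    simp only [Finset.subset_iff, Finsupp.mem_support_iff, Finset.mem_filter, Finset.mem_univ,
      true_and]
    exact forall_congr' fun i => not_imp_not
  rw [hiff]
  split_ifs with hr
  · rw [Finset.mem_coe, Finset.mem_finsuppAntidiag, hsupp, and_comm]
    refine and_congr_left fun hm => ?_
    rw [hsum hm]
    omega
  · simp only [Set.mem_empty_iff_false, iff_false, not_and]
    omega

theorem finite_integralTranslations {a : Fin k → ℝ} {h : ℕ} (ha : ∑ i, a i = h) (r : ℕ) :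
    (integralTranslations a r).Finite := by
  rw [integralTranslations_eq ha]
  split_ifs
  · exact Finset.finite_toSet _
  · exact Set.finite_empty

theorem card_integralTranslations {a : Fin k → ℝ} {h : ℕ} (ha : ∑ i, a i = h) (r : ℕ) :
    Nat.card (integralTranslations a r) = if h ≤ r then
      ((Finset.univ.filter fun i => a i ≠ 0).card + (r - h) - 1).choose (r - h) else 0 := by
  rw [integralTranslations_eq ha]
  split_ifs
  · rw [Nat.card_coe_set_eq, Set.ncard_coe_finset, Finset.card_finsuppAntidiag_nat_eq_choose]
  · simp

theorem exists_polynomial_card_integralTranslations {a : Fin k → ℝ} {h : ℕ} (ha1 : a ≤ 1)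
    (ha : ∑ i, a i = h) : ∃ p : Polynomial ℚ, ∀ r : ℕ, 0 < r →
      p.eval (r : ℚ) = Nat.card (integralTranslations a r) := by
  have hle : h ≤ (Finset.univ.filter fun i => a i ≠ 0).card := by
    have : (h : ℝ) ≤ (Finset.univ.filter fun i => a i ≠ 0).card := by
      rw [← ha, ← Finset.sum_filter_ne_zero]
      exact (Finset.sum_le_sum fun i _ => ha1 i).trans (by simp)
    exact_mod_cast this
  rcases Nat.eq_zero_or_pos (Finset.univ.filter fun i => a i ≠ 0).card with hs | hs
  · refine ⟨0, fun r hr => ?_⟩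
    rw [card_integralTranslations ha, hs, Nat.choose_eq_zero_of_lt (by omega)]
    simp
  · obtain ⟨p, hp⟩ := exists_polynomial_eval_choose hs hle
    refine ⟨p, fun r hr => ?_⟩
    rw [hp r hr, card_integralTranslations ha]
    push_cast
    rfl

theorem eq_of_add_natCast_eq {a b : ℝ} {m l : ℕ} (ha : a ≤ 1) (hb : 0 ≤ b)
    (hl : b = 0 → l = 0) (h : a + m = b + l) : l ≤ m := by
  by_contra! hlt
  have hlt' : (m : ℝ) + 1 ≤ l := by exact_mod_cast hlt
  have := hl (by linarith)
  omega

theorem card_dilateLatticePoints (v : Fin k → Fin n → ℤ) (r : ℕ) :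
    Nat.card (dilateLatticePoints v r) =
      Nat.card (Σ a : fundamentalSet v, integralTranslations a.1 r) := by
  have hker : ∀ c, homogenization v c = 0 → ∑ i, c i = 0 := fun c hc => by
    rw [homogenization_apply] at hc
    exact congrArg Prod.snd hc
  have hex : ∀ p : Σ a : fundamentalSet v, integralTranslations a.1 r,
      ∃ x : Fin n → ℤ, homogenization v (fun i => p.1.1 i + p.2.1 i) =
        (fun j => (x j : ℝ), (r : ℝ)) := by
    rintro ⟨⟨a, -, -, -, x, h, hx⟩, m, -, hm⟩
    refine ⟨fun j => x j + ∑ i, m i * v i j, ?_⟩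
    rw [homogenization_apply, Prod.mk.injEq] at hx ⊢
    refine ⟨funext fun j => ?_, hm⟩
    have := congrFun hx.1 j
    push_cast
    rw [← this, ← Finset.sum_add_distrib]
    exact Finset.sum_congr rfl fun i _ => add_mul _ _ _
  choose X hX using hex
  have hmax : ∀ p : Σ a : fundamentalSet v, integralTranslations a.1 r,
      IsLexMax (homogenization v) fun i => p.1.1 i + p.2.1 i := fun p =>
    p.1.2.2.2.1.congr fun i hi => by simp [hi, p.2.2.1 i hi]
  have hnonneg : ∀ p : Σ a : fundamentalSet v, integralTranslations a.1 r,
      0 ≤ fun i => p.1.1 i + (p.2.1 i : ℝ) := fun p i =>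
    add_nonneg (p.1.2.1 i) (Nat.cast_nonneg _)
  refine (Nat.card_eq_of_bijective
    (fun p => (⟨X p, _, hnonneg p, hX p⟩ : dilateLatticePoints v r)) ⟨fun p q hpq => ?_, ?_⟩).symm
  · have hpq : X p = X q := congrArg Subtype.val hpq
    have hsum := (hmax p).eq (hmax q) (hnonneg p) (hnonneg q) (by rw [hX, hX, hpq])
    have hm : ∀ i, p.2.1 i = q.2.1 i := fun i =>
      le_antisymm
        (eq_of_add_natCast_eq (q.1.2.2.1 i) (p.1.2.1 i) (p.2.2.1 i) (congrFun hsum i).symm)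
        (eq_of_add_natCast_eq (p.1.2.2.1 i) (q.1.2.1 i) (q.2.2.1 i) (congrFun hsum i))
    refine Sigma.subtype_ext (Subtype.ext (funext fun i => ?_)) (Finsupp.ext hm)
    have := congrFun hsum i
    simp only [hm i] at this
    exact add_right_cancel this
  · rintro ⟨x, a, ha, hx⟩
    obtain ⟨b, hb0, hbT, hb⟩ := exists_isLexMax hker ha
    rw [hx] at hbT
    let m : Fin k →₀ ℕ := Finsupp.equivFunOnFinite.symm fun i => ⌈b i⌉₊ - 1
    have hm0 : ∀ i, b i = 0 → m i = 0 := fun i hi => by simp [m, hi]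
    have hm : ∀ i, 0 < b i → (m i : ℝ) = ⌈b i⌉₊ - 1 := fun i hi => by
      have : 1 ≤ ⌈b i⌉₊ := Nat.ceil_pos.2 hi
      simp [m, Nat.cast_sub this]
    have hlt : ∀ i, 0 < b i → (m i : ℝ) < b i := fun i hi => by
      rw [hm i hi]
      linarith [Nat.ceil_lt_add_one hi.le]
    have hc0 : 0 ≤ fun i => b i - m i := fun i => by
      rcases (hb0 i).eq_or_lt with h | h
      · simp [← h, hm0 i h.symm]
      · exact sub_nonneg.2 (hlt i h).le
    have hc1 : (fun i => b i - (m i : ℝ)) ≤ 1 := fun i => by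
      change b i - m i ≤ 1
      rcases (hb0 i).eq_or_lt with h | h
      · simp [← h, hm0 i h.symm]
      · rw [hm i h]
        linarith [Nat.le_ceil (b i)]
    rw [homogenization_apply, Prod.mk.injEq] at hbT
    have hle : ∑ i, m i ≤ r := by
      have : ∑ i, (m i : ℝ) ≤ r := by
        rw [← hbT.2]
        exact Finset.sum_le_sum fun i _ => sub_nonneg.1 (hc0 i)
      exact_mod_cast this
    have hc : (fun i => b i - (m i : ℝ)) ∈ fundamentalSet v := by
      refine ⟨hc0, hc1, hb.congr fun i hi => by simp [hi, hm0 i hi],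
        fun j => x j - ∑ i, m i * v i j, r - ∑ i, m i, ?_⟩
      rw [homogenization_apply, Prod.mk.injEq]
      refine ⟨funext fun j => ?_, ?_⟩
      · have := congrFun hbT.1 j
        push_cast
        rw [← this, ← Finset.sum_sub_distrib]
        exact Finset.sum_congr rfl fun i _ => sub_mul _ _ _
      · rw [Finset.sum_sub_distrib, hbT.2, Nat.cast_sub hle]
        push_cast
        rfl
    have hmr : m ∈ integralTranslations (fun i => b i - (m i : ℝ)) r := by
      refine ⟨fun i hi => ?_, by simpa using hbT.2⟩
      rcases (hb0 i).eq_or_lt with h | h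
      · exact hm0 i h.symm
      · exact absurd (sub_eq_zero.1 hi) (hlt i h).ne'
    refine ⟨⟨⟨_, hc⟩, ⟨m, hmr⟩⟩, Subtype.ext (funext fun j => ?_)⟩
    have hXb := hX ⟨⟨_, hc⟩, ⟨m, hmr⟩⟩
    simp only [sub_add_cancel] at hXb
    rw [homogenization_apply, Prod.mk.injEq, hbT.1] at hXb
    exact (Int.cast_injective (α := ℝ) (congrFun hXb.1 j)).symm

theorem exists_polynomial_card_dilateLatticePoints (v : Fin k → Fin n → ℤ) :
    ∃ p : Polynomial ℚ, ∀ r : ℕ, 0 < r →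
      p.eval (r : ℚ) = Nat.card (dilateLatticePoints v r) := by
  have := (finite_fundamentalSet v).fintype
  have hsum : ∀ a : fundamentalSet v, ∃ h : ℕ, ∑ i, a.1 i = h := by
    rintro ⟨a, -, -, -, x, h, hx⟩
    rw [homogenization_apply] at hx
    exact ⟨h, congrArg Prod.snd hx⟩
  choose h hh using hsum
  choose p hp using fun a : fundamentalSet v =>
    exists_polynomial_card_integralTranslations a.2.2.1 (hh a)
  refine ⟨∑ a, p a, fun r hr => ?_⟩
  have (a : fundamentalSet v) : Finite (integralTranslations a.1 r) :=
    (finite_integralTranslations (hh a) r).to_subtype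
  rw [card_dilateLatticePoints, Nat.card_sigma, Polynomial.eval_finsetSum, Nat.cast_sum]
  exact Finset.sum_congr rfl fun a _ => hp a r hr

/-! ### The leading coefficient -/

/-- A polynomial whose values are asymptotic to `c * r ^ n` with `c ≠ 0` has degree `n` and
leading coefficient `c`. -/
theorem degree_eq_and_leadingCoeff_eq {p : Polynomial ℝ} {n : ℕ} {c : ℝ} (hc : c ≠ 0)
    (h : Tendsto (fun r : ℕ => p.eval (r : ℝ) / (r : ℝ) ^ n) atTop (𝓝 c)) :
    p.degree = n ∧ p.leadingCoeff = c := by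
  have hcomp {l : Filter ℝ} {f : ℝ → ℝ} (hf : Tendsto f atTop l) :
      Tendsto (fun r : ℕ => f r) atTop l := hf.comp tendsto_natCast_atTop_atTop
  have hX : (Polynomial.X ^ n : Polynomial ℝ).degree = n := Polynomial.degree_X_pow n
  rcases lt_trichotomy p.degree (Polynomial.X ^ n : Polynomial ℝ).degree with hlt | heq | hgt
  · have := hcomp (Polynomial.div_tendsto_atTop_zero_of_degree_lt _ _ hlt)
    simp only [Polynomial.eval_pow, Polynomial.eval_X] at this
    exact absurd (tendsto_nhds_unique h this) hc
  · refine ⟨heq.trans hX, ?_⟩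
    have := hcomp (Polynomial.div_tendsto_atTop_leadingCoeff_div_of_degree_eq _ _ heq)
    simp only [Polynomial.eval_pow, Polynomial.eval_X, Polynomial.leadingCoeff_X_pow,
      div_one] at this
    exact tendsto_nhds_unique this h
  · have := hcomp (Polynomial.abs_div_tendsto_atTop_atTop_of_degree_gt _ _ hgt
      (pow_ne_zero _ Polynomial.X_ne_zero))
    simp only [Polynomial.eval_pow, Polynomial.eval_X] at this
    exact absurd h.abs (not_tendsto_nhds_of_tendsto_atTop this _)

/-- The integer points of `r • s`, rescaled, are the points of `s` in the lattice `r⁻¹ • ℤⁿ`. -/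
theorem card_latticePoints_smul (s : Set (Fin n → ℝ)) {r : ℝ} (hr : r ≠ 0) :
    Nat.card {x : Fin n → ℤ | (fun i => (x i : ℝ)) ∈ r • s} =
      Nat.card ↑(s ∩ r⁻¹ •
        (Submodule.span ℤ (Set.range (Pi.basisFun ℝ (Fin n))) : Set (Fin n → ℝ))) := by
  have hmem (y : Fin n → ℝ) : y ∈ Submodule.span ℤ (Set.range (Pi.basisFun ℝ (Fin n))) ↔
      ∃ x : Fin n → ℤ, y = fun i => (x i : ℝ) := by
    rw [Module.Basis.mem_span_iff_repr_mem]
    simp only [Pi.basisFun_repr, Set.mem_range, algebraMap_int_eq, eq_intCast]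
    constructor
    · intro h
      choose x hx using h
      exact ⟨x, funext fun i => (hx i).symm⟩
    · rintro ⟨x, rfl⟩ i
      exact ⟨x i, rfl⟩
  refine Nat.card_eq_of_bijective
    (fun x => ⟨r⁻¹ • fun i => (x.1 i : ℝ), (Set.mem_smul_set_iff_inv_smul_mem₀ hr _ _).1 x.2,
      Set.smul_mem_smul_set ((hmem _).2 ⟨_, rfl⟩)⟩) ⟨fun x y hxy => ?_, ?_⟩
  · have := smul_right_injective _ (inv_ne_zero hr) (congrArg Subtype.val hxy)
    exact Subtype.ext (funext fun i => Int.cast_injective (congrFun this i))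
  · rintro ⟨_, hys, y, hy, rfl⟩
    obtain ⟨x, rfl⟩ := (hmem y).1 hy
    exact ⟨⟨x, (Set.mem_smul_set_iff_inv_smul_mem₀ hr _ _).2 hys⟩, rfl⟩

theorem mem_smul_convexHull_iff (v : Fin k → Fin n → ℤ) {r : ℕ} (hr : 0 < r) (x : Fin n → ℤ) :
    (fun j => (x j : ℝ)) ∈ (r : ℝ) • convexHull ℝ (Set.range fun i j => (v i j : ℝ)) ↔
      x ∈ dilateLatticePoints v r := by
  have hr' : (0 : ℝ) < r := by exact_mod_cast hr
  have hhull : convexHull ℝ (Set.range fun i j => (v i j : ℝ)) =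
      Fintype.linearCombination ℝ (fun i j => (v i j : ℝ)) '' stdSimplex ℝ (Fin k) := by
    rw [← convexHull_rangle_single_eq_stdSimplex, LinearMap.image_convexHull, ← Set.range_comp]
    congr 2
    ext i : 1
    simp [Fintype.linearCombination_apply_single]
  have happ (a : Fin k → ℝ) : Fintype.linearCombination ℝ (fun i j => (v i j : ℝ)) a =
      fun j => ∑ i, a i * v i j := by
    ext; simp [Fintype.linearCombination_apply]
  rw [hhull]
  constructor
  · rintro ⟨_, ⟨a, ha, rfl⟩, hx⟩
    refine ⟨(r : ℝ) • a, smul_nonneg hr'.le fun i => ha.1 i, ?_⟩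
    rw [homogenization_apply, Prod.mk.injEq, ← hx, ← happ, map_smul]
    exact ⟨rfl, by simp [← Finset.mul_sum, ha.2]⟩
  · rintro ⟨a, ha, hx⟩
    rw [homogenization_apply, Prod.mk.injEq, ← happ] at hx
    refine ⟨_, ⟨(r : ℝ)⁻¹ • a, ⟨fun i => mul_nonneg (inv_nonneg.2 hr'.le) (ha i), ?_⟩, rfl⟩, ?_⟩
    · simp [← Finset.mul_sum, hx.2, hr'.ne']
    · simp [hx.1, hr'.ne']

end Ehrhart

/-- Ehrhart's theorem: if `K` is a convex polytope in `ℝⁿ` with positive volume and vertices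
in `ℤⁿ`, then there is a polynomial `p` of degree `n` with rational coefficients and leading
coefficient `Vol_n(K)` such that `|ℤⁿ ∩ rK| = p(r)` for every positive integer `r`. -/
theorem ehrhart (n : ℕ) (V : Finset (Fin n → ℤ)) (K : Set (Fin n → ℝ))
    (hK : K = convexHull ℝ ((fun v : Fin n → ℤ => fun i => (v i : ℝ)) '' ↑V))
    (hKvol : 0 < volume K) :
    ∃ p : Polynomial ℚ, p.degree = n ∧ ((p.leadingCoeff : ℝ) = (volume K).toReal) ∧
      ∀ r : ℕ, 0 < r →
        (Nat.card {v : Fin n → ℤ | (fun i => (v i : ℝ)) ∈ (r : ℝ) • K} : ℚ) =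
          p.eval (r : ℚ) := by
  subst hK
  obtain ⟨k, ⟨e⟩⟩ : ∃ k, Nonempty (Fin k ≃ V) := ⟨_, ⟨V.equivFin.symm⟩⟩
  have hrange : (fun v : Fin n → ℤ => fun i => (v i : ℝ)) '' ↑V =
      Set.range fun i j => ((e i).1 j : ℝ) := by
    rw [show (fun i j => ((e i).1 j : ℝ)) =
      (fun v : Fin n → ℤ => fun i => (v i : ℝ)) ∘ Subtype.val ∘ e from rfl, Set.range_comp,
      e.surjective.range_comp, Subtype.range_coe_subtype]
    rfl
  have hfin : ((fun v : Fin n → ℤ => fun i => (v i : ℝ)) '' (↑V : Set (Fin n → ℤ))).Finite :=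
    V.finite_toSet.image _
  set K := convexHull ℝ ((fun v : Fin n → ℤ => fun i => (v i : ℝ)) '' ↑V) with hKdef
  have hcompact : IsCompact K := hfin.isCompact_convexHull ℝ
  have hconvex : Convex ℝ K := convex_convexHull ℝ _
  obtain ⟨p, hp⟩ := Ehrhart.exists_polynomial_card_dilateLatticePoints fun i => (e i).1
  have hcount : ∀ r : ℕ, 0 < r →
      (Nat.card {v : Fin n → ℤ | (fun i => (v i : ℝ)) ∈ (r : ℝ) • K} : ℚ) = p.eval (r : ℚ) := by
    intro r hr
    rw [hp r hr, hKdef, hrange]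
    simp_rw [Ehrhart.mem_smul_convexHull_iff (fun i => (e i).1) hr]
    rfl
  have hlim := tendsto_card_div_pow_atTop_volume K hcompact.isBounded hcompact.measurableSet
    (hconvex.addHaar_frontier volume)
  have hvol : volume.real K ≠ 0 :=
    (ENNReal.toReal_pos hKvol.ne' hcompact.measure_lt_top.ne).ne'
  obtain ⟨hdeg, hlead⟩ := Ehrhart.degree_eq_and_leadingCoeff_eq
    (p := p.map (algebraMap ℚ ℝ)) (n := n) hvol (by
      refine hlim.congr' ?_
      filter_upwards [Filter.eventually_gt_atTop 0] with r hr
      rw [← Ehrhart.card_latticePoints_smul K (by exact_mod_cast hr.ne'), Fintype.card_fin]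
      congr 1
      have := congrArg (algebraMap ℚ ℝ) (hcount r hr)
      rw [← Polynomial.eval_map_apply] at this
      simpa using this)
  refine ⟨p, by simpa using hdeg, ?_, hcount⟩
  rw [Polynomial.leadingCoeff_map] at hlead
  exact hlead
end
end

section
/- (Pick's theorem) Let P be a convex polygon in ℝ² with positive area and all vertices in ℤ². Let I be the number of points of ℤ² in the interior of P and E the number of points of ℤ² on the boundary of P. Then the area S of P satisfies S = I + E/2 − 1. -/
open MeasureTheory
noncomputable section

/-- The average of the floor and the ceiling of a real number. -/
def midround (x : ℝ) : ℝ := ((⌊x⌋ : ℝ) + ⌈x⌉) / 2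

theorem midround_intCast (n : ℤ) : midround n = n := by
  simp [midround]

theorem midround_neg (x : ℝ) : midround (-x) = -midround x := by
  simp only [midround, Int.floor_neg, Int.ceil_neg]
  push_cast
  ring

theorem midround_intCast_sub (n : ℤ) (x : ℝ) : midround (n - x) = n - midround x := by
  have h : (n : ℝ) - x = -x + n := by ring
  simp only [midround, h, Int.floor_add_intCast, Int.ceil_add_intCast, Int.floor_neg, Int.ceil_neg]
  push_cast
  ring

/-- The trapezoidal sum of `midround ∘ g` over the integers from `a` to `b`. -/
def trapezoidSum (g : ℝ → ℝ) (a b : ℤ) : ℝ :=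
  ∑ k ∈ Finset.Ico a b, (midround (g k) + midround (g (k + 1 : ℤ))) / 2

theorem trapezoidSum_add (g : ℝ → ℝ) {a b c : ℤ} (hab : a ≤ b) (hbc : b ≤ c) :
    trapezoidSum g a b + trapezoidSum g b c = trapezoidSum g a c := by
  unfold trapezoidSum
  rw [← Finset.Ico_union_Ico_eq_Ico hab hbc,
    Finset.sum_union (Finset.Ico_disjoint_Ico_consecutive a b c)]

theorem trapezoidSum_eq_sum_Ioo (g : ℝ → ℝ) {a b : ℤ} (hab : a < b) :
    trapezoidSum g a b =
      ∑ k ∈ Finset.Ioo a b, midround (g k) + (midround (g a) + midround (g b)) / 2 := by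
  have h₁ : ∑ k ∈ Finset.Ico a b, midround (g k) =
      midround (g a) + ∑ k ∈ Finset.Ioo a b, midround (g k) := by
    rw [← Finset.Ioo_insert_left hab, Finset.sum_insert (by simp)]
  have h₂ : ∑ k ∈ Finset.Ico a b, midround (g (k + 1 : ℤ)) =
      midround (g b) + ∑ k ∈ Finset.Ioo a b, midround (g k) := by
    rw [← Finset.sum_insert (f := fun k : ℤ => midround (g k)) (by simp),
      Finset.Ioo_insert_right hab]
    refine Finset.sum_nbij' (fun k => k + 1) (fun k => k - 1) (by simp) (by simp) (by simp)
      (by simp) (by simp)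
  unfold trapezoidSum
  rw [← Finset.sum_div, Finset.sum_add_distrib, h₁, h₂]
  ring

theorem trapezoidSum_of_symmetric (g : ℝ → ℝ) {p q : ℤ} (hpq : p ≤ q) (n : ℤ)
    (hg : ∀ k ∈ Finset.Icc p q, g (p + q - k : ℤ) = n - g k) :
    trapezoidSum g p q = (q - p) * n / 2 := by
  have h : trapezoidSum g p q = ∑ k ∈ Finset.Ico p q, (n : ℝ) - trapezoidSum g p q := by
    conv_lhs => unfold trapezoidSum
    unfold trapezoidSum
    rw [← Finset.sum_sub_distrib]
    refine Finset.sum_nbij' (fun k => p + q - 1 - k) (fun k => p + q - 1 - k) ?_ ?_ ?_ ?_ ?_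
    · simp; omega
    · simp; omega
    · simp
    · simp
    · intro k hk
      rw [Finset.mem_Ico] at hk
      have h₁ := hg (p + q - 1 - k) (by simp; omega)
      have h₂ := hg (p + q - 1 - k + 1) (by simp; omega)
      rw [show p + q - (p + q - 1 - k) = k + 1 by ring] at h₁
      rw [show p + q - (p + q - 1 - k + 1) = k by ring] at h₂
      rw [h₁, h₂, midround_intCast_sub, midround_intCast_sub]
      ring
  have hc : ((q - p).toNat : ℝ) = q - p := by
    rw [← Int.cast_natCast, Int.toNat_of_nonneg (by omega)]
    push_cast; rfl
  rw [Finset.sum_const, Int.card_Ico, nsmul_eq_mul, hc] at h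
  linarith

theorem integral_eq_trapezoidSum_of_affine (g : ℝ → ℝ) {p q : ℤ} (hpq : p ≤ q) (y z : ℤ) (m : ℝ)
    (hg : ∀ x ∈ Set.Icc (p : ℝ) q, g x = y + m * (x - p)) (hz : (z : ℝ) = y + m * (q - p)) :
    IntervalIntegrable g volume p q ∧ ∫ x in (p : ℝ)..q, g x = trapezoidSum g p q := by
  have hpq' : (p : ℝ) ≤ q := by exact_mod_cast hpq
  have he : Set.EqOn (fun x => y + m * (x - p)) g (Set.uIcc (p : ℝ) q) := by
    intro x hx
    rw [Set.uIcc_of_le hpq'] at hx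
    exact (hg x hx).symm
  have hc : Continuous fun x : ℝ => (y : ℝ) + m * (x - p) := by fun_prop
  constructor
  · exact (hc.intervalIntegrable p q).congr (he.mono Set.uIoc_subset_uIcc)
  · rw [← intervalIntegral.integral_congr he, trapezoidSum_of_symmetric g hpq (y + z)]
    · have hd : ∀ x ∈ Set.uIcc (p : ℝ) q,
          HasDerivAt (fun x : ℝ => y * x + m * (x - p) ^ 2 / 2) (y + m * (x - p)) x := by
        intro x _
        have h := ((hasDerivAt_id' x).const_mul (y : ℝ)).fun_add
          (((((hasDerivAt_id' x).sub_const (p : ℝ)).fun_pow 2).const_mul m).div_const 2)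
        refine h.congr_deriv ?_
        norm_num
        ring
      rw [intervalIntegral.integral_eq_sub_of_hasDerivAt hd (hc.intervalIntegrable p q)]
      push_cast
      rw [hz]
      ring
    · intro k hk
      rw [Finset.mem_Icc] at hk
      have h₁ : (p : ℝ) ≤ k := by exact_mod_cast hk.1
      have h₂ : (k : ℝ) ≤ q := by exact_mod_cast hk.2
      rw [hg k ⟨h₁, h₂⟩, hg]
      · push_cast
        rw [hz]
        ring
      · push_cast
        constructor <;> linarith

/-- `g` is the upper boundary function of the convex hull of `W` over `[a, b]`. -/
structure IsUpperHull (W : Finset (ℤ × ℤ)) (a b : ℤ) (g : ℝ → ℝ) : Prop where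
  mem_Icc : ∀ v ∈ W, v.1 ∈ Set.Icc a b
  exists_left : ∃ v ∈ W, v.1 = a
  exists_right : ∃ v ∈ W, v.1 = b
  concaveOn : ConcaveOn ℝ (Set.Icc (a : ℝ) b) g
  le : ∀ v ∈ W, (v.2 : ℝ) ≤ g v.1
  le_of_forall_le : ∀ m c : ℝ, (∀ v ∈ W, (v.2 : ℝ) ≤ c + m * v.1) →
    ∀ x ∈ Set.Icc (a : ℝ) b, g x ≤ c + m * x

namespace IsUpperHull

variable {W : Finset (ℤ × ℤ)} {a b : ℤ} {g : ℝ → ℝ}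

theorem le_of_forall_le_slope (h : IsUpperHull W a b g) {m y p : ℝ}
    (hm : ∀ v ∈ W, (v.2 : ℝ) ≤ y + m * (v.1 - p)) {x : ℝ} (hx : x ∈ Set.Icc (a : ℝ) b) :
    g x ≤ y + m * (x - p) := by
  have := h.le_of_forall_le m (y - m * p) (fun v hv => by linarith [hm v hv]) x hx
  linarith

theorem cast_mem_Icc (h : IsUpperHull W a b g) {v : ℤ × ℤ} (hv : v ∈ W) :
    (v.1 : ℝ) ∈ Set.Icc (a : ℝ) b := by
  have := h.mem_Icc v hv
  exact ⟨by exact_mod_cast this.1, by exact_mod_cast this.2⟩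

theorem eq_of_support (h : IsUpperHull W a b g) {v : ℤ × ℤ} (hv : v ∈ W) {m : ℝ}
    (hm : ∀ w ∈ W, (w.2 : ℝ) ≤ v.2 + m * (w.1 - v.1)) : g v.1 = v.2 := by
  have := h.le_of_forall_le_slope hm (h.cast_mem_Icc hv)
  simp only [sub_self, mul_zero, add_zero] at this
  exact le_antisymm this (h.le v hv)

theorem exists_next_vertex (h : IsUpperHull W a b g) {v : ℤ × ℤ} (hvb : v.1 < b) {m : ℝ}
    (hm : ∀ w ∈ W, (w.2 : ℝ) ≤ v.2 + m * (w.1 - v.1)) :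
    ∃ u ∈ W, v.1 < u.1 ∧ ∃ s : ℝ, (u.2 : ℝ) = v.2 + s * (u.1 - v.1) ∧
      ∀ w ∈ W, (w.2 : ℝ) ≤ v.2 + s * (w.1 - v.1) := by
  obtain ⟨r, hr, hrb⟩ := h.exists_right
  obtain ⟨u, hu, hmax⟩ := (W.filter (fun w => v.1 < w.1)).exists_max_image
    (fun w => ((w.2 : ℝ) - v.2) / (w.1 - v.1)) ⟨r, by simp [hr, hrb, hvb]⟩
  simp only [Finset.mem_filter] at hu hmax
  have hpos : ∀ w : ℤ × ℤ, v.1 < w.1 → (0 : ℝ) < w.1 - v.1 := fun w hw => by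
    have : (v.1 : ℝ) < w.1 := by exact_mod_cast hw
    linarith
  have hup := hpos u hu.2
  refine ⟨u, hu.1, hu.2, ((u.2 : ℝ) - v.2) / (u.1 - v.1), ?_, fun w hw => ?_⟩
  · field_simp
    ring
  · rcases lt_or_ge v.1 w.1 with hlt | hle
    · have := hmax w ⟨hw, hlt⟩
      rw [div_le_iff₀ (hpos w hlt)] at this
      linarith
    · have hs : ((u.2 : ℝ) - v.2) / (u.1 - v.1) ≤ m := by
        rw [div_le_iff₀ hup]
        linarith [hm u hu.1]
      have hle' : (w.1 : ℝ) - v.1 ≤ 0 := by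
        have : (w.1 : ℝ) ≤ v.1 := by exact_mod_cast hle
        linarith
      nlinarith [hm w hw]

theorem eq_affine (h : IsUpperHull W a b g) {v u : ℤ × ℤ} (hv : v ∈ W) (hu : u ∈ W)
    (hvu : v.1 < u.1) {s : ℝ} (hus : (u.2 : ℝ) = v.2 + s * (u.1 - v.1))
    (hs : ∀ w ∈ W, (w.2 : ℝ) ≤ v.2 + s * (w.1 - v.1)) {x : ℝ}
    (hx : x ∈ Set.Icc (v.1 : ℝ) u.1) : g x = v.2 + s * (x - v.1) := by
  have hv' := h.cast_mem_Icc hv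
  have hu' := h.cast_mem_Icc hu
  apply le_antisymm
  · exact h.le_of_forall_le_slope hs ⟨hv'.1.trans hx.1, hx.2.trans hu'.2⟩
  · have hlt : (v.1 : ℝ) < u.1 := by exact_mod_cast hvu
    have hd : (0 : ℝ) < u.1 - v.1 := sub_pos.2 hlt
    have hcomb : ((u.1 - x) / (u.1 - v.1) : ℝ) + (x - v.1) / (u.1 - v.1) = 1 := by
      field_simp
      ring
    have h₁ : (0 : ℝ) ≤ (u.1 - x) / (u.1 - v.1) := div_nonneg (by linarith [hx.2]) hd.le
    have h₂ : (0 : ℝ) ≤ (x - v.1) / (u.1 - v.1) := div_nonneg (by linarith [hx.1]) hd.le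
    have hc := h.concaveOn.2 hv' hu' h₁ h₂ hcomb
    simp only [smul_eq_mul] at hc
    have hxe : ((u.1 - x) / (u.1 - v.1) * v.1 + (x - v.1) / (u.1 - v.1) * u.1 : ℝ) = x := by
      field_simp
      ring
    rw [hxe] at hc
    have hye : ((u.1 - x) / (u.1 - v.1) * v.2 + (x - v.1) / (u.1 - v.1) * u.2 : ℝ) =
        v.2 + s * (x - v.1) := by
      rw [hus]
      field_simp
      ring
    have := mul_le_mul_of_nonneg_left (h.le v hv) h₁
    have := mul_le_mul_of_nonneg_left (h.le u hu) h₂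
    linarith

theorem integral_eq_of_support (h : IsUpperHull W a b g) (n : ℕ) :
    ∀ v ∈ W, (b - v.1).toNat = n → (∃ m : ℝ, ∀ w ∈ W, (w.2 : ℝ) ≤ v.2 + m * (w.1 - v.1)) →
      IntervalIntegrable g volume v.1 b ∧ ∫ x in (v.1 : ℝ)..b, g x = trapezoidSum g v.1 b ∧
        ∃ k : ℤ, g b = k := by
  induction n using Nat.strong_induction_on with
  | _ n ih =>
    rintro v hv hn ⟨m, hm⟩
    rcases (h.mem_Icc v hv).2.eq_or_lt with hvb | hvb
    · have := h.eq_of_support hv hm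
      rw [hvb] at this ⊢
      exact ⟨by simp, by simp [trapezoidSum], v.2, this⟩
    · obtain ⟨u, hu, hvu, s, hus, hs⟩ := h.exists_next_vertex hvb hm
      have hub := (h.mem_Icc u hu).2
      obtain ⟨hi, he, hk⟩ := ih (b - u.1).toNat (by omega) u hu rfl
        ⟨s, fun w hw => by linarith [hs w hw]⟩
      obtain ⟨hi', he'⟩ := integral_eq_trapezoidSum_of_affine g hvu.le v.2 u.2 s
        (fun x hx => h.eq_affine hv hu hvu hus hs hx) hus
      refine ⟨hi'.trans hi, ?_, hk⟩
      rw [← intervalIntegral.integral_add_adjacent_intervals hi' hi, he, he',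
        trapezoidSum_add g hvu.le hub]

theorem integral_eq (h : IsUpperHull W a b g) :
    IntervalIntegrable g volume a b ∧ ∫ x in (a : ℝ)..b, g x = trapezoidSum g a b ∧
      (∃ k : ℤ, g a = k) ∧ ∃ k : ℤ, g b = k := by
  obtain ⟨l, hl, hla⟩ := h.exists_left
  obtain ⟨v, hv, hmax⟩ := (W.filter (fun w => w.1 = a)).exists_max_image (fun w => w.2)
    ⟨l, by simp [hl, hla]⟩
  simp only [Finset.mem_filter] at hv hmax
  obtain ⟨r, -, hr⟩ := W.exists_max_image
    (fun w => ((w.2 : ℝ) - v.2) / (w.1 - v.1)) ⟨v, hv.1⟩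
  have hs : ∀ w ∈ W, (w.2 : ℝ) ≤ v.2 + ((r.2 : ℝ) - v.2) / (r.1 - v.1) * (w.1 - v.1) := by
    intro w hw
    rcases (h.mem_Icc w hw).1.eq_or_lt with haw | haw
    · have : (w.2 : ℝ) ≤ v.2 := by exact_mod_cast hmax w ⟨hw, haw.symm⟩
      rw [← haw, hv.2]
      simpa using this
    · have hpos : (0 : ℝ) < w.1 - v.1 := by
        rw [hv.2, sub_pos]
        exact_mod_cast haw
      have := hr w hw
      rw [div_le_iff₀ hpos] at this
      linarith
  obtain ⟨hi, he, hk⟩ := h.integral_eq_of_support _ v hv.1 rfl ⟨_, hs⟩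
  have hga := h.eq_of_support hv.1 hs
  rw [hv.2] at hi he hga
  exact ⟨hi, he, ⟨v.2, hga⟩, hk⟩

end IsUpperHull

theorem exists_concaveOn_max {P : Set (Fin 2 → ℝ)} (hconv : Convex ℝ P) (hcomp : IsCompact P)
    {a b : ℝ} (hne : ∀ x ∈ Set.Icc a b, ∃ y, ![x, y] ∈ P) {σ : ℝ} (hσ : σ * σ = 1) :
    ∃ g : ℝ → ℝ, ConcaveOn ℝ (Set.Icc a b) g ∧ ∀ x ∈ Set.Icc a b, ![x, σ * g x] ∈ P ∧
      ∀ y, ![x, y] ∈ P → σ * y ≤ g x := by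
  have hex : ∀ x, ∃ z : ℝ, x ∈ Set.Icc a b →
      ![x, σ * z] ∈ P ∧ ∀ y, ![x, y] ∈ P → σ * y ≤ z := by
    intro x
    by_cases hx : x ∈ Set.Icc a b
    · obtain ⟨y, hy⟩ := hne x hx
      have hcl : IsClosed {p : Fin 2 → ℝ | p 0 = x} :=
        isClosed_eq (continuous_apply 0) continuous_const
      obtain ⟨p, ⟨hp, hpx⟩, hmax⟩ := (hcomp.inter_right hcl).exists_isMaxOn
        ⟨![x, y], hy, by simp⟩ (f := fun p => σ * p 1) (by fun_prop)
      refine ⟨σ * p 1, fun _ => ⟨?_, fun z hz => ?_⟩⟩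
      · rw [← mul_assoc, hσ, one_mul]
        convert hp using 1
        ext i
        fin_cases i
        · exact hpx.symm
        · rfl
      · simpa using hmax (show ![x, z] ∈ P ∩ {p : Fin 2 → ℝ | p 0 = x} from ⟨hz, by simp⟩)
    · exact ⟨0, fun h => absurd h hx⟩
  choose g hg using hex
  refine ⟨g, ⟨convex_Icc a b, ?_⟩, hg⟩
  intro x hx y hy s t hs ht hst
  have hmem := hconv (hg x hx).1 (hg y hy).1 hs ht hst
  have h := (hg _ (convex_Icc a b hx hy hs ht hst)).2 (s * (σ * g x) + t * (σ * g y))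
    (by simpa using hmem)
  have : σ * (s * (σ * g x) + t * (σ * g y)) = (σ * σ) * (s * g x + t * g y) := by ring
  rw [this, hσ, one_mul] at h
  exact h

theorem isUpperHull_of_max {V : Finset (Fin 2 → ℤ)} {P : Set (Fin 2 → ℝ)}
    (hP : P = convexHull ℝ ((fun v : Fin 2 → ℤ => fun i => (v i : ℝ)) '' ↑V)) {a b : ℤ}
    (hV : ∀ v ∈ V, v 0 ∈ Set.Icc a b) (ha : ∃ v ∈ V, v 0 = a) (hb : ∃ v ∈ V, v 0 = b)
    {τ : ℤ} {g : ℝ → ℝ} (hg : ConcaveOn ℝ (Set.Icc (a : ℝ) b) g) (hτ : (τ : ℝ) * τ = 1)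
    (hgP : ∀ x ∈ Set.Icc (a : ℝ) b, ![x, τ * g x] ∈ P ∧ ∀ y, ![x, y] ∈ P → τ * y ≤ g x) :
    IsUpperHull (V.image fun v => (v 0, τ * v 1)) a b g where
  mem_Icc := by simpa using hV
  exists_left := by simpa using ha
  exists_right := by simpa using hb
  concaveOn := hg
  le := by
    simp only [Finset.mem_image]
    rintro _ ⟨v, hv, rfl⟩
    have hab := hV v hv
    have hx : (v 0 : ℝ) ∈ Set.Icc (a : ℝ) b :=
      ⟨by exact_mod_cast hab.1, by exact_mod_cast hab.2⟩
    have := (hgP _ hx).2 (v 1) (by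
      rw [hP]
      apply subset_convexHull
      refine ⟨v, hv, ?_⟩
      ext i
      fin_cases i <;> rfl)
    push_cast
    exact this
  le_of_forall_le := by
    intro m c hmc x hx
    have hsub : P ⊆ {p | τ * p 1 ≤ c + m * p 0} := by
      rw [hP]
      apply convexHull_min
      · rintro _ ⟨v, hv, rfl⟩
        have := hmc _ (Finset.mem_image_of_mem _ hv)
        simpa using this
      · intro p hp q hq s t hs ht hst
        simp only [Set.mem_ofPred_eq, Pi.add_apply, Pi.smul_apply, smul_eq_mul] at hp hq ⊢
        have h₁ := mul_le_mul_of_nonneg_left hp hs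
        have h₂ := mul_le_mul_of_nonneg_left hq ht
        have h₃ : c = (s + t) * c := by rw [hst, one_mul]
        linarith
    have := hsub (hgP x hx).1
    simp only [Set.mem_ofPred_eq, Matrix.cons_val_zero, Matrix.cons_val_one, ← mul_assoc, hτ,
      one_mul] at this
    exact this

/-- The region between the graphs of `f` and `g` over `[a, b]`, as a subset of the plane. -/
def closedRegion (f g : ℝ → ℝ) (a b : ℝ) : Set (Fin 2 → ℝ) :=
  {p | p 0 ∈ Set.Icc a b ∧ p 1 ∈ Set.Icc (f (p 0)) (g (p 0))}

theorem exists_eq_closedRegion {V : Finset (Fin 2 → ℤ)} (hne : V.Nonempty)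
    {P : Set (Fin 2 → ℝ)}
    (hP : P = convexHull ℝ ((fun v : Fin 2 → ℤ => fun i => (v i : ℝ)) '' ↑V)) :
    ∃ (a b : ℤ) (f g : ℝ → ℝ) (W W' : Finset (ℤ × ℤ)), P = closedRegion f g a b ∧ a ≤ b ∧
      (∀ x ∈ Set.Icc (a : ℝ) b, f x ≤ g x) ∧
      IsUpperHull W a b g ∧ IsUpperHull W' a b (fun x => -f x) := by
  obtain ⟨l, hl, hmin⟩ := V.exists_min_image (fun v => v 0) hne
  obtain ⟨r, hr, hmax⟩ := V.exists_max_image (fun v => v 0) hne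
  have hconv : Convex ℝ P := hP ▸ convex_convexHull ℝ _
  have hcomp : IsCompact P :=
    by
    rw [hP]
    exact (V.finite_toSet.image _).isCompact_convexHull ℝ
  have hmem : ∀ v ∈ V, (fun i => (v i : ℝ)) ∈ P := fun v hv => by
    rw [hP]
    exact subset_convexHull ℝ _ ⟨v, hv, rfl⟩
  have hslab : P ⊆ {p | p 0 ∈ Set.Icc (l 0 : ℝ) (r 0)} := by
    rw [hP]
    apply convexHull_min
    · rintro _ ⟨v, hv, rfl⟩
      exact ⟨Int.cast_le.2 (hmin v hv), Int.cast_le.2 (hmax v hv)⟩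
    · exact (convex_Icc (l 0 : ℝ) (r 0)).is_linear_preimage (f := fun p : Fin 2 → ℝ => p 0)
        (IsLinearMap.mk (fun _ _ => rfl) fun _ _ => rfl)
  have hslice : ∀ x ∈ Set.Icc (l 0 : ℝ) (r 0), ∃ y, ![x, y] ∈ P := by
    intro x hx
    have himg : Convex ℝ ((fun p : Fin 2 → ℝ => p 0) '' P) :=
      hconv.is_linear_image (IsLinearMap.mk (fun _ _ => rfl) fun _ _ => rfl)
    obtain ⟨p, hp, rfl⟩ := himg.ordConnected.out ⟨_, hmem l hl, rfl⟩ ⟨_, hmem r hr, rfl⟩ hx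
    refine ⟨p 1, ?_⟩
    convert hp using 1
    ext i
    fin_cases i <;> rfl
  obtain ⟨g, hgc, hg⟩ := exists_concaveOn_max hconv hcomp hslice (σ := (1 : ℤ)) (by norm_num)
  obtain ⟨f, hfc, hf⟩ := exists_concaveOn_max hconv hcomp hslice (σ := (-1 : ℤ)) (by norm_num)
  have hW := isUpperHull_of_max hP (fun v hv => ⟨hmin v hv, hmax v hv⟩) ⟨l, hl, rfl⟩ ⟨r, hr, rfl⟩
    hgc (by norm_num) hg
  have hW' := isUpperHull_of_max hP (fun v hv => ⟨hmin v hv, hmax v hv⟩) ⟨l, hl, rfl⟩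
    ⟨r, hr, rfl⟩ hfc (by norm_num) hf
  refine ⟨l 0, r 0, fun x => -f x, g, _, _, ?_, hmin r hr, ?_, hW, by simpa using hW'⟩
  · ext p
    have hp : p = ![p 0, p 1] := by
      ext i
      fin_cases i <;> rfl
    constructor
    · intro h
      have hx := hslab h
      rw [hp] at h
      have h₁ := (hg _ hx).2 _ h
      have h₂ := (hf _ hx).2 _ h
      push_cast at h₁ h₂
      exact ⟨hx, by linarith, by linarith⟩
    · rintro ⟨hx, h⟩
      have hline : Convex ℝ {y : ℝ | ![p 0, y] ∈ P} := by
        intro y hy z hz s t hs ht hst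
        have := hconv hy hz hs ht hst
        simpa [← add_mul, hst] using this
      rw [hp]
      refine hline.ordConnected.out (hf _ hx).1 (hg _ hx).1 ?_
      push_cast
      simpa using h
  · intro x hx
    have := (hf x hx).2 _ (hg x hx).1
    push_cast at this
    linarith

theorem volume_closedRegion {f g : ℝ → ℝ} {a b : ℝ} (hab : a ≤ b)
    (hfg : ∀ x ∈ Set.Icc a b, f x ≤ g x) (hf : IntervalIntegrable f volume a b)
    (hg : IntervalIntegrable g volume a b) (hm : MeasurableSet (closedRegion f g a b)) :
    volume (closedRegion f g a b) = ENNReal.ofReal (∫ x in a..b, (g x - f x)) := by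
  have hmp := (volume_preserving_finTwoArrow ℝ).symm
  rw [← hmp.measure_preimage hm.nullMeasurableSet, Measure.volume_eq_prod,
    Measure.prod_apply (hmp.measurable hm)]
  have hs : ∀ x, volume (Prod.mk x ⁻¹' ((MeasurableEquiv.finTwoArrow (α := ℝ)).symm ⁻¹'
      closedRegion f g a b)) =
        (Set.Icc a b).indicator (fun x => ENNReal.ofReal (g x - f x)) x := by
    intro x
    by_cases hx : x ∈ Set.Icc a b
    · rw [Set.indicator_of_mem hx, ← Real.volume_Icc]
      congr 1
      ext y
      simp only [closedRegion, Set.mem_preimage, Set.mem_ofPred_eq]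
      exact ⟨fun h => h.2, fun h => ⟨hx, h⟩⟩
    · rw [Set.indicator_of_notMem hx, ← measure_empty (μ := (volume : Measure ℝ))]
      congr 1
      ext y
      simp only [closedRegion, Set.mem_preimage, Set.mem_ofPred_eq, Set.mem_empty_iff_false,
        iff_false]
      exact fun h => hx h.1
  simp_rw [hs]
  have hi := hg.sub hf
  rw [intervalIntegrable_iff_integrableOn_Icc_of_le hab] at hi
  rw [lintegral_indicator measurableSet_Icc, intervalIntegral.integral_of_le hab,
    ← integral_Icc_eq_integral_Ioc, ofReal_integral_eq_lintegral_ofReal hi]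
  rw [Filter.EventuallyLE, ae_restrict_iff' measurableSet_Icc]
  exact Filter.Eventually.of_forall fun x hx => sub_nonneg.2 (hfg x hx)

theorem ConcaveOn.pos_of_mem_Ioo {a b : ℝ} {d : ℝ → ℝ} (hd : ConcaveOn ℝ (Set.Icc a b) d)
    (hnonneg : ∀ x ∈ Set.Icc a b, 0 ≤ d x) {z : ℝ} (hz : z ∈ Set.Icc a b) (hdz : 0 < d z)
    {x : ℝ} (hx : x ∈ Set.Ioo a b) : 0 < d x := by
  have key : ∀ w ∈ Set.Icc a b, x ∈ openSegment ℝ z w → 0 < d x := by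
    rintro w hw ⟨s, t, hs, ht, hst, rfl⟩
    have h := hd.2 hz hw hs.le ht.le hst
    have h₁ := mul_pos hs hdz
    have h₂ := mul_nonneg ht.le (hnonneg w hw)
    simp only [smul_eq_mul] at h ⊢
    linarith
  have hab := hx.1.trans hx.2
  rcases lt_trichotomy z x with h | rfl | h
  · refine key b (Set.right_mem_Icc.2 hab.le) ?_
    rw [openSegment_eq_Ioo (h.trans hx.2)]
    exact ⟨h, hx.2⟩
  · exact hdz
  · refine key a (Set.left_mem_Icc.2 hab.le) ?_
    rw [openSegment_symm, openSegment_eq_Ioo (hx.1.trans h)]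
    exact ⟨hx.1, h⟩

theorem interior_closedRegion {f g : ℝ → ℝ} {a b : ℝ}
    (hf : ContinuousOn f (Set.Ioo a b)) (hg : ContinuousOn g (Set.Ioo a b)) :
    interior (closedRegion f g a b) =
      {p | p 0 ∈ Set.Ioo a b ∧ p 1 ∈ Set.Ioo (f (p 0)) (g (p 0))} := by
  apply Set.Subset.antisymm
  · intro p hp
    have hp' : closedRegion f g a b ∈ nhds p := mem_interior_iff_mem_nhds.1 hp
    have hmap : ∀ i : Fin 2, ∃ ε > 0, ∀ t ∈ Set.Icc (-ε) ε,
        Function.update p i (p i + t) ∈ closedRegion f g a b := by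
      intro i
      have hc : Continuous fun t : ℝ => Function.update p i (p i + t) := by fun_prop
      have := hc.continuousAt.preimage_mem_nhds (x := 0) (by simpa using hp')
      obtain ⟨ε, hε, h⟩ := Metric.nhds_basis_closedBall.mem_iff.1 this
      refine ⟨ε, hε, fun t ht => h ?_⟩
      rwa [Real.closedBall_eq_Icc, zero_sub, zero_add]
    obtain ⟨ε, hε, h₀⟩ := hmap 0
    obtain ⟨δ, hδ, h₁⟩ := hmap 1
    have e₁ := (h₀ (-ε) (by constructor <;> linarith)).1.1
    have e₂ := (h₀ ε (by constructor <;> linarith)).1.2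
    have e₃ := (h₁ (-δ) (by constructor <;> linarith)).2.1
    have e₄ := (h₁ δ (by constructor <;> linarith)).2.2
    simp at e₁ e₂ e₃ e₄
    exact ⟨⟨by linarith, by linarith⟩, by linarith, by linarith⟩
  · apply interior_maximal
    · rintro p ⟨hx, hy⟩
      exact ⟨Set.Ioo_subset_Icc_self hx, Set.Ioo_subset_Icc_self hy⟩
    · have hU : IsOpen {p : Fin 2 → ℝ | p 0 ∈ Set.Ioo a b} :=
        isOpen_Ioo.preimage (continuous_apply 0)
      have hmaps : Set.MapsTo (fun p : Fin 2 → ℝ => p 0) {p | p 0 ∈ Set.Ioo a b} (Set.Ioo a b) :=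
        fun p hp => hp
      have hf' := hf.comp (continuous_apply 0).continuousOn hmaps
      have hg' := hg.comp (continuous_apply 0).continuousOn hmaps
      have h₁ : ContinuousOn (fun p : Fin 2 → ℝ => p 1 - f (p 0)) {p | p 0 ∈ Set.Ioo a b} :=
        (continuous_apply 1).continuousOn.sub hf'
      have h₂ : ContinuousOn (fun p : Fin 2 → ℝ => g (p 0) - p 1) {p | p 0 ∈ Set.Ioo a b} :=
        hg'.sub (continuous_apply 1).continuousOn
      convert (h₁.isOpen_inter_preimage hU (isOpen_Ioi (a := 0))).inter
        (h₂.isOpen_inter_preimage hU (isOpen_Ioi (a := 0))) using 1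
      ext p
      simp only [Set.mem_ofPred_eq, Set.mem_inter_iff, Set.mem_preimage, Set.mem_Ioi, sub_pos,
        Set.mem_Ioo]
      tauto

theorem ncard_setOf_mem_sigma (s : Finset ℤ) (t : ℤ → Finset ℤ) :
    {v : Fin 2 → ℤ | v 0 ∈ s ∧ v 1 ∈ t (v 0)}.Finite ∧
      {v : Fin 2 → ℤ | v 0 ∈ s ∧ v 1 ∈ t (v 0)}.ncard = ∑ k ∈ s, (t k).card := by
  have h : {v : Fin 2 → ℤ | v 0 ∈ s ∧ v 1 ∈ t (v 0)} =
      (fun x : Σ _ : ℤ, ℤ => ![x.1, x.2]) '' (s.sigma t : Finset _) := by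
    ext v
    simp only [Set.mem_ofPred_eq, Set.mem_image, Finset.mem_coe, Finset.mem_sigma]
    constructor
    · intro hv
      refine ⟨⟨v 0, v 1⟩, hv, ?_⟩
      ext i
      fin_cases i <;> rfl
    · rintro ⟨x, hx, rfl⟩
      exact hx
  have hinj : Function.Injective (fun x : Σ _ : ℤ, ℤ => ![x.1, x.2]) := by
    rintro ⟨x, y⟩ ⟨x', y'⟩ h
    have h₀ := congrFun h 0
    have h₁ := congrFun h 1
    simp at h₀ h₁
    rw [h₀, h₁]
  rw [h]
  exact ⟨(Finset.finite_toSet _).image _, by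
    rw [Set.ncard_image_of_injective _ hinj, Set.ncard_coe_finset, Finset.card_sigma]⟩

theorem ncard_interior_closedRegion {f g : ℝ → ℝ} {a b : ℤ}
    (hf : ContinuousOn f (Set.Ioo (a : ℝ) b)) (hg : ContinuousOn g (Set.Ioo (a : ℝ) b))
    (hfg : ∀ x ∈ Set.Ioo (a : ℝ) b, f x < g x) :
    {v : Fin 2 → ℤ | (fun i => (v i : ℝ)) ∈ interior (closedRegion f g a b)}.Finite ∧
      ({v : Fin 2 → ℤ | (fun i => (v i : ℝ)) ∈ interior (closedRegion f g a b)}.ncard : ℝ) =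
        ∑ k ∈ Finset.Ioo a b, ((⌈g k⌉ : ℝ) - ⌊f k⌋ - 1) := by
  have h : {v : Fin 2 → ℤ | (fun i => (v i : ℝ)) ∈ interior (closedRegion f g a b)} =
      {v | v 0 ∈ Finset.Ioo a b ∧ v 1 ∈ Finset.Ioo ⌊f (v 0)⌋ ⌈g (v 0)⌉} := by
    ext v
    simp [interior_closedRegion hf hg, Int.floor_lt, Int.lt_ceil]
  obtain ⟨hfin, hcard⟩ := ncard_setOf_mem_sigma (Finset.Ioo a b)
    fun k => Finset.Ioo ⌊f k⌋ ⌈g k⌉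
  rw [h]
  refine ⟨hfin, ?_⟩
  rw [hcard, Nat.cast_sum]
  refine Finset.sum_congr rfl fun k hk => ?_
  rw [Finset.mem_Ioo] at hk
  have hk' := hfg k ⟨by exact_mod_cast hk.1, by exact_mod_cast hk.2⟩
  have hlt : ⌊f k⌋ < ⌈g k⌉ := Int.floor_lt.2 (hk'.trans_le (Int.le_ceil _))
  rw [Int.card_Ioo, ← Int.cast_natCast, Int.toNat_of_nonneg (by omega)]
  push_cast
  rfl

theorem ncard_closedRegion {f g : ℝ → ℝ} {a b : ℤ}
    (hfg : ∀ x ∈ Set.Icc (a : ℝ) b, f x ≤ g x) :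
    ({v : Fin 2 → ℤ | (fun i => (v i : ℝ)) ∈ closedRegion f g a b}.ncard : ℝ) =
      ∑ k ∈ Finset.Icc a b, ((⌊g k⌋ : ℝ) + 1 - ⌈f k⌉) ∧
    {v : Fin 2 → ℤ | (fun i => (v i : ℝ)) ∈ closedRegion f g a b}.Finite := by
  have h : {v : Fin 2 → ℤ | (fun i => (v i : ℝ)) ∈ closedRegion f g a b} =
      {v | v 0 ∈ Finset.Icc a b ∧ v 1 ∈ Finset.Icc ⌈f (v 0)⌉ ⌊g (v 0)⌋} := by
    ext v
    simp [closedRegion, Int.ceil_le, Int.le_floor]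
  obtain ⟨hfin, hcard⟩ := ncard_setOf_mem_sigma (Finset.Icc a b)
    fun k => Finset.Icc ⌈f k⌉ ⌊g k⌋
  rw [h]
  refine ⟨?_, hfin⟩
  rw [hcard, Nat.cast_sum]
  refine Finset.sum_congr rfl fun k hk => ?_
  rw [Finset.mem_Icc] at hk
  have hk' := hfg k ⟨by exact_mod_cast hk.1, by exact_mod_cast hk.2⟩
  have hle : ⌈f k⌉ ≤ ⌊g k⌋ + 1 := Int.ceil_le.2 (by
    push_cast
    linarith [Int.lt_floor_add_one (g k)])
  rw [Int.card_Icc, ← Int.cast_natCast, Int.toNat_of_nonneg (by omega)]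
  push_cast
  rfl

theorem sum_Icc_eq_sum_Ioo_add (F : ℤ → ℝ) {a b : ℤ} (hab : a < b) :
    ∑ k ∈ Finset.Icc a b, F k = ∑ k ∈ Finset.Ioo a b, F k + F a + F b := by
  rw [← Finset.Ico_insert_right hab.le, Finset.sum_insert (by simp),
    ← Finset.Ioo_insert_left hab, Finset.sum_insert (by simp)]
  ring

theorem ncard_closedRegion_add_ncard_interior {f g : ℝ → ℝ} {a b : ℤ} (hab : a < b)
    (hf : ContinuousOn f (Set.Ioo (a : ℝ) b)) (hg : ContinuousOn g (Set.Ioo (a : ℝ) b))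
    (hfg : ∀ x ∈ Set.Icc (a : ℝ) b, f x ≤ g x) (hlt : ∀ x ∈ Set.Ioo (a : ℝ) b, f x < g x)
    (hga : ∃ k : ℤ, g a = k) (hgb : ∃ k : ℤ, g b = k)
    (hfa : ∃ k : ℤ, -f a = k) (hfb : ∃ k : ℤ, -f b = k) :
    ({v : Fin 2 → ℤ | (fun i => (v i : ℝ)) ∈ closedRegion f g a b}.ncard : ℝ) +
      {v : Fin 2 → ℤ | (fun i => (v i : ℝ)) ∈ interior (closedRegion f g a b)}.ncard =
    2 * (trapezoidSum g a b + trapezoidSum (fun x => -f x) a b) + 2 := by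
  obtain ⟨k₁, h₁⟩ := hga
  obtain ⟨k₂, h₂⟩ := hgb
  obtain ⟨k₃, h₃⟩ := hfa
  obtain ⟨k₄, h₄⟩ := hfb
  have h₃' : f a = (-k₃ : ℤ) := by
    push_cast
    linarith
  have h₄' : f b = (-k₄ : ℤ) := by
    push_cast
    linarith
  have hsum : ∑ k ∈ Finset.Ioo a b, ((⌊g k⌋ : ℝ) + 1 - ⌈f k⌉) +
      ∑ k ∈ Finset.Ioo a b, ((⌈g k⌉ : ℝ) - ⌊f k⌋ - 1) =
      2 * (∑ k ∈ Finset.Ioo a b, midround (g k) + ∑ k ∈ Finset.Ioo a b, midround (-f k)) := by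
    rw [← Finset.sum_add_distrib, ← Finset.sum_add_distrib, Finset.mul_sum]
    refine Finset.sum_congr rfl fun k _ => ?_
    rw [midround_neg]
    unfold midround
    ring
  rw [(ncard_closedRegion hfg).1, (ncard_interior_closedRegion hf hg hlt).2,
    sum_Icc_eq_sum_Ioo_add _ hab, trapezoidSum_eq_sum_Ioo _ hab, trapezoidSum_eq_sum_Ioo _ hab,
    h₁, h₂, h₃, h₄, h₃', h₄']
  simp only [midround_intCast, Int.floor_intCast, Int.ceil_intCast]
  push_cast
  linarith

/-- Pick's theorem: for a convex lattice polygon `P` in `ℝ²` with positive area, with `I`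
interior lattice points and `E` boundary lattice points, the area satisfies
`S = I + E/2 − 1`. -/
theorem pick (V : Finset (Fin 2 → ℤ)) (P : Set (Fin 2 → ℝ))
    (hP : P = convexHull ℝ ((fun v : Fin 2 → ℤ => fun i => (v i : ℝ)) '' ↑V))
    (hPvol : 0 < volume P) :
    (volume P).toReal =
      (Nat.card {v : Fin 2 → ℤ | (fun i => (v i : ℝ)) ∈ interior P} : ℝ) +
        (Nat.card {v : Fin 2 → ℤ | (fun i => (v i : ℝ)) ∈ frontier P} : ℝ) / 2 - 1 := by
  have hne : V.Nonempty := by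
    rw [Finset.nonempty_iff_ne_empty]
    rintro rfl
    simp [hP] at hPvol
  have hclosed : IsClosed P := by
    rw [hP]
    exact ((V.finite_toSet.image _).isCompact_convexHull ℝ).isClosed
  obtain ⟨a, b, f, g, W, W', rfl, hle, hfg, hW, hW'⟩ := exists_eq_closedRegion hne hP
  obtain ⟨hgi, hgint, hga, hgb⟩ := hW.integral_eq
  obtain ⟨hfi', hfint, hfa, hfb⟩ := hW'.integral_eq
  have hfi : IntervalIntegrable f volume a b := by
    simpa [Function.comp_def, Pi.neg_def] using hfi'.neg
  have hvol := volume_closedRegion (by exact_mod_cast hle) hfg hfi hgi hclosed.measurableSet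
  rw [hvol, ENNReal.ofReal_pos] at hPvol
  have hint : ∫ x in (a : ℝ)..b, (g x - f x) =
      trapezoidSum g a b + trapezoidSum (fun x => -f x) a b := by
    rw [← hgint, ← hfint, ← intervalIntegral.integral_add hgi hfi']
    simp only [sub_eq_add_neg]
  have hlt : a < b := by
    refine hle.lt_of_ne ?_
    rintro rfl
    simp at hPvol
  have hfc : ContinuousOn f (Set.Ioo (a : ℝ) b) := by
    have := hW'.concaveOn.continuousOn_interior
    rw [interior_Icc] at this
    simpa only [neg_neg] using this.fun_neg
  have hgc : ContinuousOn g (Set.Ioo (a : ℝ) b) := by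
    have := hW.concaveOn.continuousOn_interior
    rwa [interior_Icc] at this
  have hd : ConcaveOn ℝ (Set.Icc (a : ℝ) b) fun x => g x - f x := by
    simp only [sub_eq_add_neg]
    exact hW.concaveOn.add hW'.concaveOn
  have hpos : ∃ z ∈ Set.Icc (a : ℝ) b, 0 < g z - f z := by
    by_contra! h
    have := intervalIntegral.integral_nonneg (μ := volume) (by exact_mod_cast hle)
      fun x hx => neg_nonneg.2 (h x hx)
    rw [intervalIntegral.integral_neg] at this
    linarith
  obtain ⟨z, hz, hdz⟩ := hpos
  have hfg' : ∀ x ∈ Set.Ioo (a : ℝ) b, f x < g x := fun x hx =>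
    sub_pos.1 (hd.pos_of_mem_Ioo (fun x hx => sub_nonneg.2 (hfg x hx)) hz hdz hx)
  have hcount := ncard_closedRegion_add_ncard_interior hlt hfc hgc hfg hfg' hga hgb hfa hfb
  have hfin := (ncard_closedRegion hfg).2
  have hsub : {v : Fin 2 → ℤ | (fun i => (v i : ℝ)) ∈ interior (closedRegion f g a b)} ⊆
      {v : Fin 2 → ℤ | (fun i => (v i : ℝ)) ∈ closedRegion f g a b} :=
    fun _ hv => (interior_subset (s := closedRegion f g a b)) hv
  have hfrontier := Set.ncard_sdiff_add_ncard_of_subset hsub hfin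
  have hdiff : {v : Fin 2 → ℤ | (fun i => (v i : ℝ)) ∈ frontier (closedRegion f g a b)} =
      {v : Fin 2 → ℤ | (fun i => (v i : ℝ)) ∈ closedRegion f g a b} \
        {v : Fin 2 → ℤ | (fun i => (v i : ℝ)) ∈ interior (closedRegion f g a b)} := by
    rw [hclosed.frontier_eq]
    rfl
  rw [← hdiff] at hfrontier
  rw [hvol, ENNReal.toReal_ofReal hPvol.le, hint]
  simp only [Nat.card_coe_set_eq]
  rw [← hfrontier] at hcount
  push_cast at hcount
  linarith
end
end
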